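/- There exists a labeled flat splicing system of type (2, 1) with finite initial set whose Szilard language is context-sensitive but not context-free; that is, SZLS^2_{1,FIN} ∩ (CS \ CF) ≠ ∅. In particular, there is such a system LS with SZ(LS) ∩ a*b*c* = {aⁿ bⁿ⁺¹ cⁿ⁺¹ : n ≥ 1}. -/

import Mathlib

/-- A flat splicing rule `⟨α | γ−δ | β⟩`. -/
structure FlatRule (A : Type) where
  /-- left handle α -/
  lf : List A
  /-- right handle β -/
  rt : List A
  /-- first letter γ of the inserted word (a word of length ≤ 1) -/
  ins1 : List A
  /-- last letter δ of the inserted word (a word of length ≤ 1) -/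
  ins2 : List A

/-- Application of a flat splicing rule: from `u = x·α·β·y` and `v = γ·z·δ` (with `|v| ≥ 1`)
produce `w = x·α·v·β·y`. -/
def FlatRule.Splice {A : Type} (r : FlatRule A) (u v w : List A) : Prop :=
  ∃ x y z : List A,
    u = x ++ r.lf ++ r.rt ++ y ∧
    v = r.ins1 ++ z ++ r.ins2 ∧ 1 ≤ v.length ∧
    w = x ++ r.lf ++ v ++ r.rt ++ y

/-- A labeled flat splicing system `(A, I, R, Lab)`; every rule carries a label word over `Λ`
(a single letter for Szilard/control labelings, possibly the empty word for λ-labelings). -/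
structure LabeledFSS (A Λ : Type) where
  I : Set (List A)
  R : Set (FlatRule A)
  lab : FlatRule A → List Λ
  finR : R.Finite
  insBound : ∀ r ∈ R, r.ins1.length ≤ 1 ∧ r.ins2.length ≤ 1

namespace LabeledFSS

variable {A Λ : Type} (S : LabeledFSS A Λ)

/-- Some rule of the system is applicable to the word `u` (together with some initial word). -/
def Applicable (u : List A) : Prop :=
  ∃ r ∈ S.R, ∃ v ∈ S.I, ∃ w, r.Splice u v w

/-- `S.Deriv x ls` : starting from initial words, the word `x` is derivable with label word `ls`. -/
inductive Deriv : List A → List Λ → Prop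
  | start {x₀ y₀ x₁ : List A} {r : FlatRule A} :
      x₀ ∈ S.I → y₀ ∈ S.I → r ∈ S.R → r.Splice x₀ y₀ x₁ → Deriv x₁ (S.lab r)
  | step {x y w : List A} {ls : List Λ} {r : FlatRule A} :
      Deriv x ls → y ∈ S.I → r ∈ S.R → r.Splice x y w → Deriv w (ls ++ S.lab r)

/-- The derivation language (Szilard language resp. control language) of the system:
label words of terminal derivations. -/
def derLang : Language Λ :=
  { ls | ∃ x : List A, S.Deriv x ls ∧ ¬ S.Applicable x }

/-- The system has type `(m, n)`: `m` is the maximum length of the handles `α, β`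
and `n` is the maximum length of `γδ` over all rules. -/
def HasType (m n : ℕ) : Prop :=
  (∀ r ∈ S.R, r.lf.length ≤ m ∧ r.rt.length ≤ m) ∧
  (∃ r ∈ S.R, r.lf.length = m ∨ r.rt.length = m) ∧
  (∀ r ∈ S.R, r.ins1.length + r.ins2.length ≤ n) ∧
  (∃ r ∈ S.R, r.ins1.length + r.ins2.length = n)

/-- Szilard labeling: each rule is labeled by a single letter, in a one-to-one manner. -/
def SzilardLabeled : Prop :=
  (∀ r ∈ S.R, (S.lab r).length = 1) ∧ Set.InjOn S.lab S.R

/-- Control labeling: each rule is labeled by a single letter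
(distinct rules may share a label). -/
def ControlLabeled : Prop :=
  ∀ r ∈ S.R, (S.lab r).length = 1

/-- λ-control labeling: each rule is labeled by a single letter or by the empty word. -/
def LambdaControlLabeled : Prop :=
  ∀ r ∈ S.R, (S.lab r).length ≤ 1

end LabeledFSS

/-- A general (type-0 style) grammar: rewriting rules over terminals and nonterminals. -/
structure GenGrammar (T : Type) where
  /-- Type of nonterminals. -/
  NT : Type
  /-- Starting symbol. -/
  initial : NT
  /-- Rewriting rules (pairs of strings of symbols). -/
  rules : List (List (Symbol T NT) × List (Symbol T NT))

/-- One rewriting step of a general grammar. -/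
def GenGrammar.Produces {T : Type} (g : GenGrammar T)
    (u v : List (Symbol T g.NT)) : Prop :=
  ∃ r ∈ g.rules, ∃ p q : List (Symbol T g.NT), u = p ++ r.1 ++ q ∧ v = p ++ r.2 ++ q

/-- Derivation relation of a general grammar. -/
def GenGrammar.Derives {T : Type} (g : GenGrammar T) :
    List (Symbol T g.NT) → List (Symbol T g.NT) → Prop :=
  Relation.ReflTransGen g.Produces

/-- The language generated by a general grammar. -/
def GenGrammar.language {T : Type} (g : GenGrammar T) : Language T :=
  { w | g.Derives [Symbol.nonterminal g.initial] (w.map Symbol.terminal) }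

/-- A language is recursively enumerable if it is generated by a type-0 grammar,
i.e. a general grammar in which every left-hand side contains a nonterminal. -/
def Language.IsRecursivelyEnumerable {T : Type} (L : Language T) : Prop :=
  ∃ g : GenGrammar T,
    (∀ r ∈ g.rules, ∃ x : g.NT, Symbol.nonterminal x ∈ r.1) ∧ g.language = L

/-- A language is context-sensitive if it is generated by a grammar in which every
left-hand side contains a nonterminal and is no longer than the right-hand side. -/
def Language.IsContextSensitive {T : Type} (L : Language T) : Prop :=
  ∃ g : GenGrammar T,
    (∀ r ∈ g.rules, (∃ x : g.NT, Symbol.nonterminal x ∈ r.1) ∧ r.1.length ≤ r.2.length) ∧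
    g.language = L

/-- A three-letter alphabet `{a, b, c}`. -/
inductive ABC : Type
  | a
  | b
  | c
deriving DecidableEq


namespace ContextFreeGrammar

/-- `Expands P s w`: the word `w` arises from `s` by keeping the terminals and replacing every
nonterminal `A` by a word `u` with `P A u`. -/
inductive Expands {T N : Type} (P : N → List T → Prop) : List (Symbol T N) → List T → Prop
  | nil : Expands P [] []
  | terminal {s : List (Symbol T N)} {w : List T} (t : T) :
      Expands P s w → Expands P (Symbol.terminal t :: s) (t :: w)
  | nonterminal {s : List (Symbol T N)} {w u : List T} {A : N} :
      P A u → Expands P s w → Expands P (Symbol.nonterminal A :: s) (u ++ w)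

namespace Expands

variable {T N : Type} {P Q : N → List T → Prop} {s : List (Symbol T N)} {w : List T}

theorem mono (hPQ : ∀ A u, P A u → Q A u) (h : Expands P s w) : Expands Q s w := by
  induction h with
  | nil => exact .nil
  | terminal t _ ih => exact .terminal t ih
  | nonterminal hA _ ih => exact .nonterminal (hPQ _ _ hA) ih

theorem length_le {m : ℕ} (hm : 1 ≤ m) (hP : ∀ A u, P A u → u.length ≤ m) (h : Expands P s w) :
    w.length ≤ s.length * m := by
  induction h with
  | nil => simp
  | terminal t _ ih => simp only [List.length_cons]; nlinarith
  | nonterminal hA _ ih =>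
    have := hP _ _ hA
    simp only [List.length_cons, List.length_append]; nlinarith

theorem map_terminal (w : List T) : Expands P (w.map Symbol.terminal) w := by
  induction w with
  | nil => exact .nil
  | cons t w ih => exact .terminal t ih

theorem append {s' : List (Symbol T N)} {w' : List T} (h : Expands P s w) (h' : Expands P s' w') :
    Expands P (s ++ s') (w ++ w') := by
  induction h with
  | nil => exact h'
  | terminal t _ ih => exact .terminal t ih
  | nonterminal hA _ ih =>
    rw [List.append_assoc]
    exact .nonterminal hA ih

theorem exists_of_append {s' : List (Symbol T N)} (h : Expands P (s ++ s') w) :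
    ∃ w₁ w₂, w = w₁ ++ w₂ ∧ Expands P s w₁ ∧ Expands P s' w₂ := by
  induction s generalizing w with
  | nil => exact ⟨[], w, rfl, .nil, h⟩
  | cons x s ih =>
    rw [List.cons_append] at h
    cases h with
    | terminal t h =>
      obtain ⟨w₁, w₂, rfl, h₁, h₂⟩ := ih h
      exact ⟨t :: w₁, w₂, rfl, .terminal t h₁, h₂⟩
    | nonterminal hA h =>
      obtain ⟨w₁, w₂, rfl, h₁, h₂⟩ := ih h
      exact ⟨_, w₂, (List.append_assoc _ _ _).symm, .nonterminal hA h₁, h₂⟩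

end Expands

variable {T : Type} (g : ContextFreeGrammar T)

/-- `g.YieldsWithin n A w`: the nonterminal `A` has a parse tree of height at most `n` with
yield `w`. -/
def YieldsWithin : ℕ → g.NT → List T → Prop
  | 0, _, _ => False
  | n + 1, A, w => ∃ r ∈ g.rules, r.input = A ∧ Expands (YieldsWithin n) r.output w

variable {g}

theorem YieldsWithin.succ {n : ℕ} {A : g.NT} {w : List T} (h : g.YieldsWithin n A w) :
    g.YieldsWithin (n + 1) A w := by
  induction n generalizing A w with
  | zero => exact h.elim
  | succ n ih =>
    obtain ⟨r, hr, hA, hw⟩ := h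
    exact ⟨r, hr, hA, hw.mono fun _ _ => ih⟩

theorem YieldsWithin.mono {n m : ℕ} (hnm : n ≤ m) {A : g.NT} {w : List T}
    (h : g.YieldsWithin n A w) : g.YieldsWithin m A w := by
  induction hnm with
  | refl => exact h
  | step _ ih => exact ih.succ

theorem Expands.derives {P : g.NT → List T → Prop} {s : List (Symbol T g.NT)} {w : List T}
    (hP : ∀ A u, P A u → g.Derives [Symbol.nonterminal A] (u.map Symbol.terminal))
    (h : Expands P s w) : g.Derives s (w.map Symbol.terminal) := by
  induction h with
  | nil => exact .refl _
  | terminal t _ ih => exact ih.append_left [Symbol.terminal t]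
  | @nonterminal s w u A hA _ ih =>
    rw [List.map_append]
    exact ((hP _ _ hA).append_right s).trans (ih.append_left _)

theorem derives_of_mem_rules {r : ContextFreeRule T g.NT} (hr : r ∈ g.rules) :
    g.Derives [Symbol.nonterminal r.input] r.output :=
  Produces.single ⟨r, hr, ContextFreeRule.Rewrites.input_output⟩

theorem YieldsWithin.derives {n : ℕ} {A : g.NT} {w : List T} (h : g.YieldsWithin n A w) :
    g.Derives [Symbol.nonterminal A] (w.map Symbol.terminal) := by
  induction n generalizing A w with
  | zero => exact h.elim
  | succ n ih =>
    obtain ⟨r, hr, rfl, hw⟩ := h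
    exact (derives_of_mem_rules hr).trans (hw.derives fun _ _ => ih)

theorem Expands.exists_yieldsWithin {s : List (Symbol T g.NT)} {w : List T}
    (h : Expands (fun A u => ∃ n, g.YieldsWithin n A u) s w) :
    ∃ n, Expands (g.YieldsWithin n) s w := by
  induction h with
  | nil => exact ⟨0, .nil⟩
  | terminal t _ ih =>
    obtain ⟨n, hn⟩ := ih
    exact ⟨n, .terminal t hn⟩
  | nonterminal hA _ ih =>
    obtain ⟨n, hn⟩ := ih
    obtain ⟨k, hk⟩ := hA
    exact ⟨max n k, .nonterminal (hk.mono (le_max_right _ _))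
      (hn.mono fun _ _ h => h.mono (le_max_left _ _))⟩

theorem Derives.expands {s : List (Symbol T g.NT)} {w : List T}
    (h : g.Derives s (w.map Symbol.terminal)) :
    Expands (fun A u => ∃ n, g.YieldsWithin n A u) s w := by
  refine Relation.ReflTransGen.head_induction_on h (Expands.map_terminal w) ?_
  rintro s s' ⟨r, hr, hs⟩ - ih
  obtain ⟨p, q, rfl, rfl⟩ := hs.exists_parts
  obtain ⟨w', w₃, rfl, h', h₃⟩ := ih.exists_of_append
  obtain ⟨w₁, w₂, rfl, h₁, h₂⟩ := h'.exists_of_append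
  obtain ⟨n, hn⟩ := h₂.exists_yieldsWithin
  refine (h₁.append ?_).append h₃
  simpa using Expands.nonterminal (P := fun A u => ∃ n, g.YieldsWithin n A u)
    ⟨n + 1, r, hr, rfl, hn⟩ .nil

theorem Derives.exists_yieldsWithin {A : g.NT} {w : List T}
    (h : g.Derives [Symbol.nonterminal A] (w.map Symbol.terminal)) :
    ∃ n, g.YieldsWithin n A w := by
  have hE := h.expands
  clear h
  cases hE with
  | nonterminal hA hs =>
    cases hs
    simpa using hA

theorem YieldsWithin.length_le {m : ℕ} (hm : 1 ≤ m) (hg : ∀ r ∈ g.rules, r.output.length ≤ m)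
    {n : ℕ} {A : g.NT} {w : List T} (h : g.YieldsWithin n A w) : w.length ≤ m ^ n := by
  induction n generalizing A w with
  | zero => exact h.elim
  | succ n ih =>
    obtain ⟨r, hr, rfl, hw⟩ := h
    calc w.length ≤ r.output.length * m ^ n := hw.length_le (Nat.one_le_pow _ _ hm) fun _ _ => ih
      _ ≤ m * m ^ n := Nat.mul_le_mul_right _ (hg r hr)
      _ = m ^ (n + 1) := (pow_succ' m n).symm

variable (g) in
/-- `g.HasHeight n A w`: the least height of a parse tree for `A` with yield `w` is `n + 1`. -/
def HasHeight (n : ℕ) (A : g.NT) (w : List T) : Prop :=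
  g.YieldsWithin (n + 1) A w ∧ ¬ g.YieldsWithin n A w

variable (g) in
/-- The word `p.2` contains `q.2` as a factor, and `p.1` derives the surrounding context of `q.2`
with `q.1` in place of `q.2`. -/
def Embeds (p q : g.NT × List T) : Prop :=
  ∃ u v : List T, p.2 = u ++ q.2 ++ v ∧
    g.Derives [Symbol.nonterminal p.1]
      (u.map Symbol.terminal ++ [Symbol.nonterminal q.1] ++ v.map Symbol.terminal)

theorem Embeds.refl (p : g.NT × List T) : g.Embeds p p :=
  ⟨[], [], by simp, .refl _⟩

theorem Embeds.trans {p q r : g.NT × List T} (hpq : g.Embeds p q) (hqr : g.Embeds q r) :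
    g.Embeds p r := by
  obtain ⟨u, v, hp, hd⟩ := hpq
  obtain ⟨u', v', hq, hd'⟩ := hqr
  refine ⟨u ++ u', v' ++ v, by simp [hp, hq], hd.trans ?_⟩
  simpa using (hd'.append_left (u.map Symbol.terminal)).append_right (v.map Symbol.terminal)

theorem Expands.exists_hasHeight {n : ℕ} {s : List (Symbol T g.NT)} {w : List T}
    (h : Expands (g.YieldsWithin (n + 1)) s w) (h' : ¬ Expands (g.YieldsWithin n) s w) :
    ∃ B u w' v, w = u ++ w' ++ v ∧ g.HasHeight n B w' ∧
      g.Derives s (u.map Symbol.terminal ++ [Symbol.nonterminal B] ++ v.map Symbol.terminal) := by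
  induction h with
  | nil => exact (h' .nil).elim
  | terminal t _ ih =>
    obtain ⟨B, u, w', v, rfl, hB, hd⟩ := ih fun h => h' (.terminal t h)
    exact ⟨B, t :: u, w', v, by simp, hB, by simpa using hd.append_left [Symbol.terminal t]⟩
  | @nonterminal s w u A hA hs ih =>
    by_cases hA' : g.YieldsWithin n A u
    · obtain ⟨B, u', w', v, rfl, hB, hd⟩ := ih fun h => h' (.nonterminal hA' h)
      refine ⟨B, u ++ u', w', v, by simp, hB, ?_⟩
      simpa using (hA'.derives.append_right s).trans (hd.append_left _)
    · refine ⟨A, [], u, w, by simp, ⟨hA, hA'⟩, ?_⟩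
      simpa using (hs.derives fun _ _ h => h.derives).append_left [Symbol.nonterminal A]

theorem HasHeight.exists_embeds {n : ℕ} {A : g.NT} {w : List T} (h : g.HasHeight (n + 1) A w) :
    ∃ q, g.HasHeight n q.1 q.2 ∧ g.Embeds (A, w) q := by
  obtain ⟨⟨r, hr, rfl, hw⟩, h'⟩ := h
  obtain ⟨B, u, w', v, hw', hB, hd⟩ := hw.exists_hasHeight fun h => h' ⟨r, hr, rfl, h⟩
  exact ⟨(B, w'), hB, u, v, hw', (derives_of_mem_rules hr).trans hd⟩

theorem HasHeight.exists_chain {n : ℕ} {A : g.NT} {w : List T} (h : g.HasHeight n A w) :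
    ∃ f : ℕ → g.NT × List T, f n = (A, w) ∧ (∀ i ≤ n, g.HasHeight i (f i).1 (f i).2) ∧
      ∀ i j, i ≤ j → j ≤ n → g.Embeds (f j) (f i) := by
  induction n generalizing A w with
  | zero =>
    refine ⟨fun _ => (A, w), rfl, fun i hi => ?_, fun _ _ _ _ => .refl _⟩
    obtain rfl : i = 0 := by omega
    exact h
  | succ n ih =>
    obtain ⟨⟨B, w'⟩, hB, hE⟩ := h.exists_embeds
    obtain ⟨f, hf, hH, hC⟩ := ih hB
    refine ⟨Function.update f (n + 1) (A, w), by simp, fun i hi => ?_, fun i j hij hj => ?_⟩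
    · rcases eq_or_ne i (n + 1) with rfl | hne
      · simpa using h
      · simpa [hne] using hH i (by omega)
    · rcases eq_or_ne j (n + 1) with rfl | hne
      · rcases eq_or_ne i (n + 1) with rfl | hne'
        · exact .refl _
        · have hin : i ≤ n := by omega
          simpa [hne'] using hE.trans (hf ▸ hC i n hin le_rfl)
      · have hne' : i ≠ n + 1 := by omega
        simpa [hne, hne'] using hC i j hij (by omega)

theorem HasHeight.unique {n m : ℕ} {A : g.NT} {w : List T} (h : g.HasHeight n A w)
    (h' : g.HasHeight m A w) : n = m := by
  by_contra hne
  rcases Nat.lt_or_gt_of_ne hne with hlt | hlt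
  · exact h'.2 (h.1.mono hlt)
  · exact h.2 (h'.1.mono hlt)

end ContextFreeGrammar

/-- The downward half of the pumping lemma for context-free languages. -/
theorem Language.IsContextFree.exists_pump_down {T : Type} {L : Language T}
    (hL : L.IsContextFree) :
    ∃ K : ℕ, ∀ z ∈ L, K < z.length → ∃ u v w x y : List T,
      z = u ++ (v ++ w ++ x) ++ y ∧ v ++ x ≠ [] ∧ (v ++ w ++ x).length ≤ K ∧ u ++ w ++ y ∈ L := by
  classical
  obtain ⟨g, rfl⟩ := hL
  let m := g.rules.sup (fun r => r.output.length) + 1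
  have hm : 1 ≤ m := Nat.le_add_left _ _
  have hg : ∀ r ∈ g.rules, r.output.length ≤ m := fun r hr =>
    (Finset.le_sup (f := fun r : ContextFreeRule T g.NT => r.output.length) hr).trans
      (Nat.le_succ _)
  let inputs := g.rules.image ContextFreeRule.input
  refine ⟨m ^ (inputs.card + 1), fun z hz hlen => ?_⟩
  rw [ContextFreeGrammar.mem_language_iff] at hz
  obtain ⟨h₀, hh₀⟩ := ContextFreeGrammar.Derives.exists_yieldsWithin hz
  obtain ⟨h, hH⟩ : ∃ h, g.HasHeight h g.initial z := by
    have hex : ∃ n, g.YieldsWithin n g.initial z := ⟨h₀, hh₀⟩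
    have hspec := Nat.find_spec hex
    obtain ⟨k, hk⟩ : ∃ k, Nat.find hex = k + 1 := by
      refine Nat.exists_eq_succ_of_ne_zero fun h => ?_
      rw [h] at hspec
      exact hspec
    exact ⟨k, hk ▸ hspec, Nat.find_min hex (by omega)⟩
  have hbig : inputs.card < h := by
    by_contra! hle
    have := (hH.1.length_le hm hg).trans (Nat.pow_le_pow_right hm (Nat.succ_le_succ hle))
    exact absurd hlen this.not_gt
  obtain ⟨f, hf, hfH, hfC⟩ := hH.exists_chain
  have hmaps : ∀ i ∈ Finset.range (inputs.card + 1), (f i).1 ∈ inputs := by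
    intro i hi
    rw [Finset.mem_range] at hi
    obtain ⟨r, hr, hA, -⟩ := (hfH i (by omega)).1
    exact Finset.mem_image.2 ⟨r, hr, hA⟩
  obtain ⟨i, hi, j, hj, hne, heq⟩ :=
    Finset.exists_ne_map_eq_of_card_lt_of_maps_to (by simp) hmaps
  wlog hij : i < j generalizing i j
  · exact this j hj i hi hne.symm heq.symm (by omega)
  rw [Finset.mem_range] at hi hj
  obtain ⟨v, x, hvx, -⟩ := hfC i j hij.le (by omega)
  have hC := hfC j h (by omega) le_rfl
  rw [hf] at hC
  obtain ⟨u, y, huy, hd⟩ := hC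
  refine ⟨u, v, (f i).2, x, y, by simpa [hvx] using huy, fun hnil => ?_, ?_, ?_⟩
  · obtain ⟨rfl, rfl⟩ := List.append_eq_nil_iff.1 hnil
    refine hne ((hfH i (by omega)).unique ?_)
    have := hfH j (by omega)
    rw [← heq, hvx] at this
    simpa using this
  · rw [← hvx]
    exact ((hfH j (by omega)).1.length_le hm hg).trans (Nat.pow_le_pow_right hm (by omega))
  · rw [ContextFreeGrammar.mem_language_iff]
    refine hd.trans ?_
    have := (hfH i (by omega)).1.derives
    rw [heq] at this
    simpa using (this.append_left (u.map Symbol.terminal)).append_right (y.map Symbol.terminal)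

/-- The number of occurrences of `pat` as a factor of a word. -/
def List.occurrences {A : Type} [DecidableEq A] (pat : List A) : List A → ℕ
  | [] => 0
  | x :: l => (if pat <+: x :: l then 1 else 0) + List.occurrences pat l

theorem List.prefix_append_cons_iff {A : Type} {s : A} {pat : List A} (hs : s ∉ pat)
    (u w : List A) : pat <+: u ++ s :: w ↔ pat <+: u := by
  induction pat generalizing u with
  | nil => simp
  | cons t pat ih =>
    simp only [List.mem_cons, not_or] at hs
    cases u with
    | nil => simp [List.cons_prefix_cons, Ne.symm hs.1]
    | cons x u => simp [List.cons_prefix_cons, ih hs.2]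

theorem List.occurrences_append_cons {A : Type} [DecidableEq A] {s : A} {pat : List A}
    (hs : s ∉ pat) (u w : List A) :
    List.occurrences (s :: pat) (u ++ s :: w) =
      List.occurrences (s :: pat) u + List.occurrences (s :: pat) (s :: w) := by
  induction u with
  | nil => simp [List.occurrences]
  | cons x u ih =>
    simp only [List.cons_append, List.occurrences, List.cons_prefix_cons,
      List.prefix_append_cons_iff hs] at ih ⊢
    omega

theorem List.exists_append_of_occurrences_pos {A : Type} [DecidableEq A] {pat l : List A}
    (h : 0 < List.occurrences pat l) : ∃ x y, l = x ++ (pat ++ y) := by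
  induction l with
  | nil => simp [List.occurrences] at h
  | cons t l ih =>
    by_cases hp : pat <+: t :: l
    · obtain ⟨y, hy⟩ := hp
      exact ⟨[], y, hy.symm⟩
    · obtain ⟨x, y, rfl⟩ := ih (by simpa [List.occurrences, hp] using h)
      exact ⟨t :: x, y, rfl⟩

namespace CountingFSS

/-- The alphabet of the splicing system. -/
inductive Letter : Type
  | X
  | Y
  | Q
  | M
  | Z
deriving DecidableEq

open Letter

instance : Fintype Letter :=
  ⟨{X, Y, Q, M, Z}, fun x => by cases x <;> simp⟩

instance : Finite ABC :=
  haveI : Fintype ABC := ⟨{.a, .b, .c}, fun x => by cases x <;> simp⟩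
  inferInstance

/-- The splicing rule with a given label. -/
def rule : ABC → FlatRule Letter
  | .a => ⟨[X], [Q, Q], [Y], []⟩
  | .b => ⟨[X], [Y], [M], []⟩
  | .c => ⟨[X], [M], [Z], []⟩

/-- Recovers the label of a rule from the first letter it inserts. -/
def label (r : FlatRule Letter) : List ABC :=
  match r.ins1 with
  | [Y] => [.a]
  | [M] => [.b]
  | _ => [.c]

@[simp] theorem label_rule (t : ABC) : label (rule t) = [t] := by
  cases t <;> rfl

/-- The word in which every nontrivial derivation starts. -/
def seed : List Letter := [X, Y, X, Q, Q]

/-- A splicing system in which each `a` opens a site for `b`, and each `b` turns its site into a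
site for `c`. -/
def system : LabeledFSS Letter ABC where
  I := {seed, [Y, X], [Y], [M], [Z]}
  R := Set.range rule
  lab := label
  finR := Set.finite_range rule
  insBound := by rintro _ ⟨t, rfl⟩; cases t <;> simp [rule]

/-- The number of positions at which the rule labeled `t` applies. -/
def sites (t : ABC) (x : List Letter) : ℕ :=
  List.occurrences (X :: (rule t).rt) x

theorem sites_append_cons (t : ABC) (u w : List Letter) :
    sites t (u ++ X :: w) = sites t u + sites t (X :: w) :=
  List.occurrences_append_cons (by cases t <;> simp [rule]) u w

theorem splice_iff {t : ABC} {u v w : List Letter} :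
    (rule t).Splice u v w ↔ (rule t).ins1 <+: v ∧
      ∃ x y, u = x ++ X :: ((rule t).rt ++ y) ∧ w = x ++ X :: (v ++ ((rule t).rt ++ y)) := by
  constructor
  · rintro ⟨x, y, z, rfl, hv, -, rfl⟩
    refine ⟨⟨z, ?_⟩, x, y, ?_, ?_⟩ <;> cases t <;> simp_all [rule]
  · rintro ⟨⟨z, hv⟩, x, y, rfl, rfl⟩
    refine ⟨x, y, z, ?_, ?_, ?_, ?_⟩ <;> cases t <;> simp_all [rule] <;> simp [← hv]

theorem sites_pos_of_splice {t : ABC} {u v w : List Letter} (h : (rule t).Splice u v w) :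
    0 < sites t u := by
  obtain ⟨-, x, y, rfl, -⟩ := splice_iff.1 h
  rw [sites_append_cons]
  cases t <;> simp [sites, List.occurrences, rule]

/-- The effect of a splicing step with an initial word on the numbers of sites. -/
theorem sites_of_splice {t : ABC} {u v w : List Letter} (hv : v ∈ system.I)
    (h : (rule t).Splice u v w) :
    match t with
    | .a => sites .b w = sites .b u + 1 ∧ sites .c w = sites .c u ∧
        sites .a u = sites .a w + (if v = [Y] then 1 else 0)
    | .b => sites .b u = sites .b w + 1 ∧ sites .c w = sites .c u + 1 ∧
        sites .a w = sites .a u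
    | .c => sites .b w = sites .b u ∧ sites .c u = sites .c w + 1 ∧
        sites .a w = sites .a u := by
  obtain ⟨hv', x, y, rfl, rfl⟩ := splice_iff.1 h
  simp only [system, Set.mem_insert_iff, Set.mem_singleton_iff] at hv
  simp only [sites_append_cons]
  rcases hv with rfl | rfl | rfl | rfl | rfl <;> cases t <;>
    simp [rule, seed, sites, List.occurrences, List.cons_prefix_cons] at hv' ⊢ <;> omega

theorem exists_splice {t : ABC} {u v : List Letter} (hu : 0 < sites t u)
    (hv : (rule t).ins1 <+: v) : ∃ w, (rule t).Splice u v w := by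
  obtain ⟨x, y, rfl⟩ := List.exists_append_of_occurrences_pos hu
  exact ⟨_, splice_iff.2 ⟨hv, x, y, rfl, rfl⟩⟩

theorem not_applicable_iff {u : List Letter} :
    ¬ system.Applicable u ↔ ∀ t, sites t u = 0 := by
  constructor
  · intro h t
    by_contra hne
    obtain ⟨w, hw⟩ := exists_splice (t := t) (v := (rule t).ins1) (Nat.pos_of_ne_zero hne)
      List.prefix_rfl
    exact h ⟨_, ⟨t, rfl⟩, _, by cases t <;> simp [system, rule], w, hw⟩
  · rintro h ⟨_, ⟨t, rfl⟩, v, -, w, hw⟩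
    exact (sites_pos_of_splice hw).ne' (h t)

/-- `Balanced p q w`: starting with `p` sites for `b` and `q` sites for `c`, the word `w` never
uses a missing site, and leaves none unused. -/
def Balanced : ℕ → ℕ → List ABC → Prop
  | p, q, [] => p = 0 ∧ q = 0
  | p, q, .a :: l => Balanced (p + 1) q l
  | p, q, .b :: l => 0 < p ∧ Balanced (p - 1) (q + 1) l
  | p, q, .c :: l => 0 < q ∧ Balanced p (q - 1) l

/-- The language of the splicing system. -/
def language : Language ABC := {w | Balanced 1 0 w ∧ ABC.a ∈ w}

theorem balanced_of_deriv {x : List Letter} {ls : List ABC} (h : system.Deriv x ls) :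
    (∀ l, Balanced (sites .b x) (sites .c x) l → Balanced 1 0 (ls ++ l)) ∧
      (ABC.a ∈ ls ∨ 0 < sites .a x) := by
  induction h with
  | @start x₀ y₀ x₁ r hx hy hr hs =>
    obtain ⟨t, rfl⟩ := hr
    have hpos := sites_pos_of_splice hs
    have hsites := sites_of_splice hy hs
    have h₀ : sites .a x₀ = 1 ∧ sites .b x₀ = 1 ∧ sites .c x₀ = 0 := by
      simp only [system, Set.mem_insert_iff, Set.mem_singleton_iff] at hx
      rcases hx with rfl | rfl | rfl | rfl | rfl <;> revert hpos <;> cases t <;> decide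
    have hlab : system.lab (rule t) = [t] := label_rule t
    rw [hlab]
    cases t <;> simp [Balanced] at * <;> grind
  | @step x y w ls r hd hy hr hs ih =>
    obtain ⟨t, rfl⟩ := hr
    have hpos := sites_pos_of_splice hs
    have hsites := sites_of_splice hy hs
    have hlab : system.lab (rule t) = [t] := label_rule t
    rw [hlab]
    refine ⟨fun l hl => ?_, ?_⟩
    · rw [List.append_assoc]
      refine ih.1 _ ?_
      cases t <;> simp [Balanced] at * <;> grind
    · cases t <;> simp at * <;> grind

theorem deriv_of_balanced {l : List ABC} {ls : List ABC} {x : List Letter}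
    (hx : (x = seed ∧ ls = []) ∨ system.Deriv x ls)
    (hl : Balanced (sites .b x) (sites .c x) l)
    (ha : sites .a x = if ABC.a ∈ l then 1 else 0) (hne : ls ++ l ≠ []) :
    ∃ x', system.Deriv x' (ls ++ l) ∧ ¬ system.Applicable x' := by
  induction l generalizing ls x with
  | nil =>
    rw [List.append_nil] at hne ⊢
    refine ⟨x, hx.resolve_left fun h => hne h.2, not_applicable_iff.2 fun t => ?_⟩
    cases t
    · simpa using ha
    · exact hl.1
    · exact hl.2
  | cons t l ih =>
    obtain ⟨v, hvI, hv, hvY⟩ : ∃ v ∈ system.I, (rule t).ins1 <+: v ∧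
        (t = .a → (v = [Y] ↔ ABC.a ∉ l)) := by
      cases t
      · by_cases hal : ABC.a ∈ l
        · exact ⟨[Y, X], by simp [system], by simp [rule], by simp [hal]⟩
        · exact ⟨[Y], by simp [system], by simp [rule], by simp [hal]⟩
      · exact ⟨[M], by simp [system], by simp [rule], by simp⟩
      · exact ⟨[Z], by simp [system], by simp [rule], by simp⟩
    have hpos : 0 < sites t x := by
      cases t
      · simp [ha]
      · exact hl.1
      · exact hl.1
    obtain ⟨w, hw⟩ := exists_splice hpos hv
    have hsites := sites_of_splice hvI hw
    have hd : system.Deriv w (ls ++ [t]) := by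
      have hlab : system.lab (rule t) = [t] := label_rule t
      rw [← hlab]
      rcases hx with ⟨rfl, rfl⟩ | hx
      · exact .start (Or.inl rfl) hvI ⟨t, rfl⟩ hw
      · exact .step hx hvI ⟨t, rfl⟩ hw
    have := ih (ls := ls ++ [t]) (Or.inr hd) (by cases t <;> simp [Balanced] at * <;> grind)
      (by cases t <;> simp at * <;> grind) (by simp)
    simpa using this

theorem derLang_system : system.derLang = language := by
  ext ls
  constructor
  · rintro ⟨x, hd, hx⟩
    rw [not_applicable_iff] at hx
    obtain ⟨h, ha⟩ := balanced_of_deriv hd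
    refine ⟨?_, ha.resolve_right (by simp [hx])⟩
    simpa using h [] ⟨hx _, hx _⟩
  · rintro ⟨h, ha⟩
    exact deriv_of_balanced (ls := []) (x := seed) (Or.inl ⟨rfl, rfl⟩) h
      (by rw [if_pos ha]; decide) (by rintro rfl; simp at ha)

theorem Balanced.append_congr {s s' : List ABC}
    (h : ∀ p q l, Balanced p q (s ++ l) → Balanced p q (s' ++ l)) (u l : List ABC) {p q : ℕ} :
    Balanced p q (u ++ s ++ l) → Balanced p q (u ++ s' ++ l) := by
  induction u generalizing p q with
  | nil => exact h p q l
  | cons t u ih =>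
    cases t
    · exact ih
    · exact And.imp_right ih
    · exact And.imp_right ih

theorem Balanced.count_eq {p q : ℕ} {w : List ABC} (h : Balanced p q w) :
    w.count .b = p + w.count .a ∧ w.count .c = q + w.count .b := by
  induction w generalizing p q with
  | nil => simpa [Balanced, eq_comm] using h
  | cons t w ih =>
    cases t
    · have := ih (p := p + 1) (q := q) h
      simp; omega
    · have := ih h.2
      have := h.1
      simp; omega
    · have := ih h.2
      have := h.1
      simp; omega

theorem balanced_replicate_a (i p q : ℕ) (l : List ABC) :
    Balanced p q (List.replicate i .a ++ l) ↔ Balanced (p + i) q l := by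
  induction i generalizing p with
  | zero => rfl
  | succ i ih =>
    rw [show p + (i + 1) = p + 1 + i by omega, ← ih]
    rfl

theorem balanced_replicate_b (j p q : ℕ) (l : List ABC) :
    Balanced p q (List.replicate j .b ++ l) ↔ j ≤ p ∧ Balanced (p - j) (q + j) l := by
  induction j generalizing p q with
  | zero => simp
  | succ j ih =>
    rw [List.replicate_succ, List.cons_append, Balanced, ih,
      show p - 1 - j = p - (j + 1) by omega, show q + 1 + j = q + (j + 1) by omega,
      ← and_assoc]
    refine and_congr_left fun _ => ?_
    omega

theorem balanced_replicate_c (k p q : ℕ) :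
    Balanced p q (List.replicate k .c) ↔ p = 0 ∧ q = k := by
  induction k generalizing q with
  | zero => rfl
  | succ k ih =>
    rw [List.replicate_succ, Balanced, ih]
    omega

theorem mem_language_iff_of_sorted {i j k : ℕ} :
    List.replicate i ABC.a ++ List.replicate j ABC.b ++ List.replicate k ABC.c ∈ language ↔
      1 ≤ i ∧ j = i + 1 ∧ k = i + 1 := by
  change Balanced _ _ _ ∧ _ ↔ _
  rw [List.append_assoc, balanced_replicate_a, balanced_replicate_b, balanced_replicate_c]
  simp
  omega

theorem language_inter_sorted :
    { w | w ∈ language ∧ ∃ i j k : ℕ, w = List.replicate i ABC.a ++ List.replicate j ABC.b ++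
        List.replicate k ABC.c } =
      { w | ∃ n : ℕ, 1 ≤ n ∧ w = List.replicate n ABC.a ++ List.replicate (n + 1) ABC.b ++
        List.replicate (n + 1) ABC.c } := by
  ext w
  constructor
  · rintro ⟨hw, i, j, k, rfl⟩
    obtain ⟨hi, rfl, rfl⟩ := mem_language_iff_of_sorted.1 hw
    exact ⟨i, hi, rfl⟩
  · rintro ⟨n, hn, rfl⟩
    exact ⟨mem_language_iff_of_sorted.2 ⟨hn, rfl, rfl⟩, n, n + 1, n + 1, rfl⟩

theorem not_isContextFree_language : ¬ language.IsContextFree := by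
  intro h
  obtain ⟨K, hK⟩ := h.exists_pump_down
  set z := List.replicate (K + 1) ABC.a ++ List.replicate (K + 1 + 1) ABC.b ++
    List.replicate (K + 1 + 1) ABC.c with hz
  have hzL : z ∈ language := mem_language_iff_of_sorted.2 ⟨by omega, rfl, rfl⟩
  obtain ⟨u, v, w, x, y, hsplit, hne, hlen, hL⟩ :=
    hK z hzL (by simp only [hz, List.length_append, List.length_replicate]; omega)
  have h₁ := hzL.1.count_eq
  have h₂ := hL.1.count_eq
  rw [hsplit] at h₁
  simp only [List.count_append] at h₁ h₂
  have hmem : ∀ t, (v ++ x).count t = (v ++ x).count .a := by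
    intro t
    cases t <;> simp only [List.count_append] <;> omega
  have hmem' : ∀ t, t ∈ v ++ w ++ x := by
    intro t
    obtain ⟨s, hs⟩ := List.exists_mem_of_ne_nil _ hne
    rw [← List.count_pos_iff, hmem, ← hmem t, List.count_pos_iff] at hs
    simp only [List.mem_append] at hs ⊢
    tauto
  obtain ⟨i, hi, hia⟩ := List.getElem_of_mem (hmem' .a)
  obtain ⟨j, hj, hjc⟩ := List.getElem_of_mem (hmem' .c)
  have hget : ∀ n (hn : n < (v ++ w ++ x).length), z[u.length + n]? = some (v ++ w ++ x)[n] := by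
    intro n hn
    rw [hsplit, List.append_assoc, List.getElem?_append_right (by omega),
      List.getElem?_append_left (by omega)]
    simp
  have hzi := hget i hi
  have hzj := hget j hj
  rw [hia] at hzi
  rw [hjc] at hzj
  simp only [hz, List.getElem?_append, List.getElem?_replicate, List.length_append,
    List.length_replicate] at hzi hzj
  split_ifs at hzi hzj <;> first | omega | simp at hzi hzj


/-- The rewriting rules of `grammar`. -/
def grammarRules : List (List (Symbol ABC (Option ABC)) × List (Symbol ABC (Option ABC))) :=
  [([.nonterminal none],
      [.nonterminal none, .nonterminal (some .a), .nonterminal (some .b),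
        .nonterminal (some .c)]),
    ([.nonterminal none],
      [.nonterminal (some .b), .nonterminal (some .c), .nonterminal (some .a),
        .nonterminal (some .b), .nonterminal (some .c)]),
    ([.nonterminal (some .b), .nonterminal (some .a)],
      [.nonterminal (some .a), .nonterminal (some .b)]),
    ([.nonterminal (some .c), .nonterminal (some .a)],
      [.nonterminal (some .a), .nonterminal (some .c)]),
    ([.nonterminal (some .c), .nonterminal (some .b)],
      [.nonterminal (some .b), .nonterminal (some .c)]),
    ([.nonterminal (some .a)], [.terminal .a]),
    ([.nonterminal (some .b)], [.terminal .b]),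
    ([.nonterminal (some .c)], [.terminal .c])]

/-- A noncontracting grammar for `language`. The nonterminal `none` is initial, and `some t` is a
movable copy of the terminal `t`. -/
abbrev grammar : GenGrammar ABC where
  NT := Option ABC
  initial := none
  rules := grammarRules

/-- The word represented by a sentential form; the initial symbol stands for the word `bcabc`. -/
def erase (s : List (Symbol ABC (Option ABC))) : List ABC :=
  s.flatMap fun
    | .terminal t => [t]
    | .nonterminal (some t) => [t]
    | .nonterminal none => [.b, .c, .a, .b, .c]

theorem erase_mem_language_of_produces {u v : List (Symbol ABC (Option ABC))}
    (h : grammar.Produces u v) (hu : erase u ∈ language) : erase v ∈ language := by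
  obtain ⟨r, hr, p, q, rfl, rfl⟩ := h
  have happ : ∀ s t, erase (s ++ t) = erase s ++ erase t := fun _ _ => List.flatMap_append
  rw [happ, happ] at hu ⊢
  have key : (∀ m n l, Balanced m n (erase r.1 ++ l) → Balanced m n (erase r.2 ++ l)) ∧
      (ABC.a ∈ erase r.1 ↔ ABC.a ∈ erase r.2) := by
    simp only [grammarRules, List.mem_cons, List.not_mem_nil, or_false] at hr
    rcases hr with rfl | rfl | rfl | rfl | rfl | rfl | rfl | rfl <;>
      simp [erase, Balanced] <;> grind
  refine ⟨Balanced.append_congr key.1 _ _ hu.1, ?_⟩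
  have := hu.2
  simp only [List.mem_append, key.2] at this ⊢
  exact this

theorem grammar_language_le : grammar.language ≤ language := by
  intro w hw
  have h : ∀ s, grammar.Derives [.nonterminal none] s → erase s ∈ language := by
    intro s hs
    induction hs with
    | refl => exact ⟨by simp [erase, Balanced], by simp [erase]⟩
    | tail _ hst ih => exact erase_mem_language_of_produces hst ih
  have := h _ hw
  rwa [show erase (w.map Symbol.terminal) = w by simp [erase, List.flatMap_map]] at this

theorem Derives.append {s t : List (Symbol ABC (Option ABC))} (h : grammar.Derives s t)
    (u v : List (Symbol ABC (Option ABC))) : grammar.Derives (u ++ s ++ v) (u ++ t ++ v) := by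
  induction h with
  | refl => exact .refl
  | tail _ hst ih =>
    obtain ⟨r, hr, p, q, rfl, rfl⟩ := hst
    exact ih.tail ⟨r, hr, u ++ p, q ++ v, by simp, by simp⟩

theorem derives_of_mem {r : List (Symbol ABC (Option ABC)) × List (Symbol ABC (Option ABC))}
    (hr : r ∈ grammar.rules) : grammar.Derives r.1 r.2 :=
  .single ⟨r, hr, [], [], by simp, by simp⟩

/-- The sentential form consisting of the movable copies of the letters of a word. -/
def lift (w : List ABC) : List (Symbol ABC (Option ABC)) :=
  w.map fun t => .nonterminal (some t)

/-- A letter moves to the left past a word all of whose letters it can be exchanged with. -/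
theorem derives_move {t : ABC} {u : List ABC} (hu : ∀ s ∈ u, (t = .a ∧ s ≠ .a) ∨ (t = .b ∧ s = .c))
    (v : List ABC) : grammar.Derives (lift (u ++ t :: v)) (lift (t :: u ++ v)) := by
  induction u with
  | nil => exact .refl
  | cons s u ih =>
    have h₁ := Derives.append (ih fun x hx => hu x (List.mem_cons_of_mem _ hx)) (lift [s]) []
    have h₂ : grammar.Derives (lift [s, t]) (lift [t, s]) := by
      refine derives_of_mem (r := (lift [s, t], lift [t, s])) ?_
      have := hu s List.mem_cons_self
      cases t <;> cases s <;> simp at this <;> simp [grammarRules, lift]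
    have h₃ := Derives.append h₂ [] (lift (u ++ v))
    simp only [lift, List.map_append, List.map_cons, List.map_nil, List.cons_append,
      List.nil_append, List.append_nil] at h₁ h₃ ⊢
    exact h₁.trans h₃

/-- The concatenation of `n` copies of a word. -/
def power (w : List ABC) (n : ℕ) : List ABC :=
  (List.replicate n w).flatten

theorem power_succ (w : List ABC) (n : ℕ) : power w (n + 1) = w ++ power w n := by
  simp [power, List.replicate_succ]

theorem power_succ' (w : List ABC) (n : ℕ) : power w (n + 1) = power w n ++ w := by
  simp [power, List.replicate_succ']

theorem mem_of_mem_power {w : List ABC} {n : ℕ} {t : ABC} (h : t ∈ power w n) : t ∈ w := by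
  obtain ⟨l, hl, ht⟩ := List.mem_flatten.1 h
  rwa [List.eq_of_mem_replicate hl] at ht

theorem derives_of_balanced {p q : ℕ} {w : List ABC} (h : Balanced p q w) :
    grammar.Derives
      (lift (power [.c] q ++ (power [.b, .c] p ++ power [.a, .b, .c] (w.count .a)))) (lift w) := by
  induction w generalizing p q with
  | nil =>
    obtain ⟨rfl, rfl⟩ := h
    exact .refl
  | cons t w ih =>
    cases t with
    | a =>
      have h₁ := Derives.append (ih (p := p + 1) (q := q) h) (lift [.a]) []
      have h₂ := derives_move (t := .a) (u := power [.c] q ++ power [.b, .c] p)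
        (v := .b :: .c :: power [.a, .b, .c] (w.count .a)) fun s hs => by
          rcases List.mem_append.1 hs with hs | hs <;> have := mem_of_mem_power hs <;>
            cases s <;> simp_all
      rw [List.count_cons_self, power_succ]
      rw [power_succ'] at h₁
      simp [lift] at h₁ h₂ ⊢
      exact h₂.trans h₁
    | b =>
      obtain ⟨hp, h⟩ := h
      obtain ⟨p, rfl⟩ := Nat.exists_eq_succ_of_ne_zero hp.ne'
      have h₁ := Derives.append (ih (p := p) (q := q + 1) h) (lift [.b]) []
      have h₂ := derives_move (t := .b) (u := power [.c] q)
        (v := .c :: (power [.b, .c] p ++ power [.a, .b, .c] (w.count .a))) fun s hs => by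
          have := mem_of_mem_power hs
          cases s <;> simp_all
      rw [List.count_cons_of_ne (by simp), Nat.succ_eq_add_one, power_succ]
      rw [power_succ'] at h₁
      simp [lift] at h₁ h₂ ⊢
      exact h₂.trans h₁
    | c =>
      obtain ⟨hq, h⟩ := h
      obtain ⟨q, rfl⟩ := Nat.exists_eq_succ_of_ne_zero hq.ne'
      have h₁ := Derives.append (ih (p := p) (q := q) h) (lift [.c]) []
      rw [List.count_cons_of_ne (by simp), Nat.succ_eq_add_one, power_succ]
      simp [lift] at h₁ ⊢
      exact h₁

theorem derives_power (n : ℕ) :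
    grammar.Derives [.nonterminal none] (lift ([.b, .c] ++ power [.a, .b, .c] (n + 1))) := by
  have h : grammar.Derives [.nonterminal none]
      (.nonterminal none :: lift (power [.a, .b, .c] n)) := by
    induction n with
    | zero => exact .refl
    | succ n ih =>
      refine ih.trans ?_
      have := Derives.append (derives_of_mem
        (r := (([.nonterminal none] : List (Symbol ABC (Option ABC))),
          .nonterminal none :: lift [.a, .b, .c]))
        (by simp [grammarRules, lift])) [] (lift (power [.a, .b, .c] n))
      simpa [power_succ, lift, GenGrammar.Derives] using this
  refine h.trans ?_
  have := Derives.append (derives_of_mem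
    (r := (([.nonterminal none] : List (Symbol ABC (Option ABC))), lift [.b, .c, .a, .b, .c]))
    (by simp [grammarRules, lift])) [] (lift (power [.a, .b, .c] n))
  simpa [power_succ, lift, GenGrammar.Derives] using this

theorem derives_lift (w : List ABC) : grammar.Derives (lift w) (w.map .terminal) := by
  induction w with
  | nil => exact .refl
  | cons t w ih =>
    have h₁ := Derives.append (derives_of_mem (r := (lift [t], [.terminal t]))
      (by cases t <;> simp [grammarRules, lift])) [] (lift w)
    have h₂ := Derives.append ih [.terminal t] []
    simp [lift] at h₁ h₂ ⊢
    exact h₁.trans h₂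

theorem isContextSensitive_language : language.IsContextSensitive := by
  refine ⟨grammar, fun r hr => ?_, le_antisymm grammar_language_le fun w hw => ?_⟩
  · simp only [grammarRules, List.mem_cons, List.not_mem_nil, or_false] at hr
    rcases hr with rfl | rfl | rfl | rfl | rfl | rfl | rfl | rfl <;> simp
  · obtain ⟨n, hn⟩ := Nat.exists_eq_succ_of_ne_zero (List.count_pos_iff.2 hw.2).ne'
    have h := derives_of_balanced hw.1
    rw [hn] at h
    exact ((derives_power n).trans h).trans (derives_lift w)

end CountingFSS

/-- There is a labeled flat splicing system of type `(2, 1)` with finite initial set whose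
Szilard language is context-sensitive but not context-free; in particular one whose Szilard
language intersected with `a*b*c*` equals `{aⁿbⁿ⁺¹cⁿ⁺¹ : n ≥ 1}`. -/
theorem stmt5 :
    ∃ (A : Type) (_ : Finite A) (S : LabeledFSS A ABC),
      S.SzilardLabeled ∧ S.I.Finite ∧ S.HasType 2 1 ∧
      Language.IsContextSensitive S.derLang ∧ ¬ Language.IsContextFree S.derLang ∧
      { w | w ∈ S.derLang ∧
          ∃ i j k : ℕ, w = List.replicate i ABC.a ++ List.replicate j ABC.b ++
            List.replicate k ABC.c }
        = { w | ∃ n : ℕ, 1 ≤ n ∧ w = List.replicate n ABC.a ++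
            List.replicate (n + 1) ABC.b ++ List.replicate (n + 1) ABC.c } := by
  refine ⟨CountingFSS.Letter, inferInstance, CountingFSS.system, ⟨?_, ?_⟩, ?_, ⟨?_, ?_, ?_, ?_⟩,
    ?_, ?_, ?_⟩
  · rintro _ ⟨t, rfl⟩
    exact congrArg List.length (CountingFSS.label_rule t)
  · rintro _ ⟨s, rfl⟩ _ ⟨t, rfl⟩ hst
    change CountingFSS.label _ = CountingFSS.label _ at hst
    rw [CountingFSS.label_rule, CountingFSS.label_rule, List.singleton_inj] at hst
    rw [hst]
  · exact Set.toFinite {CountingFSS.seed, _, _, _, _}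
  · rintro _ ⟨t, rfl⟩
    cases t <;> simp [CountingFSS.rule]
  · exact ⟨_, ⟨.a, rfl⟩, Or.inr rfl⟩
  · rintro _ ⟨t, rfl⟩
    cases t <;> simp [CountingFSS.rule]
  · exact ⟨_, ⟨.a, rfl⟩, rfl⟩
  · rw [CountingFSS.derLang_system]
    exact CountingFSS.isContextSensitive_language
  · rw [CountingFSS.derLang_system]
    exact CountingFSS.not_isContextFree_language
  · rw [CountingFSS.derLang_system]
    exact CountingFSS.language_inter_sorted
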